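/- If Ω is a star-shaped bounded smooth domain in ℝ^N (N ≥ 3), then the only solution v ∈ H¹₀(Ω) ∩ C²(Ω) ∩ C¹(Ω̄) of −Δv = |f(v)|^(2·2*−2) f(v) f'(v) in Ω with v = 0 on ∂Ω is the trivial solution v = 0. -/

import Mathlib

open MeasureTheory

section helpers
open Set Filter Topology

theorem f_deriv_all (f : ℝ → ℝ) (hodd : ∀ t : ℝ, f (-t) = -f t)
    (hf1 : ∀ t : ℝ, 0 ≤ t → HasDerivAt f ((1 + 2 * f t ^ 2) ^ (-(1/2) : ℝ)) t) (t : ℝ) :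
    HasDerivAt f ((1 + 2 * f t ^ 2) ^ (-(1/2) : ℝ)) t := by
  rcases le_total 0 t with h | h
  · exact hf1 t h
  · have h1 := hf1 (-t) (by linarith)
    have h2 : HasDerivAt (fun x => - f (-x)) (-(((1 + 2 * f (-t) ^ 2) ^ (-(1/2) : ℝ)) * (-1))) t :=
      (h1.comp t (hasDerivAt_neg t)).neg
    have h3 : (fun x => - f (-x)) = f := by funext x; rw [hodd]; ring
    rw [h3, hodd] at h2
    simpa using h2

theorem f_strict_pos (f : ℝ → ℝ) (hf0 : f 0 = 0)
    (hf : ∀ t : ℝ, HasDerivAt f ((1 + 2 * f t ^ 2) ^ (-(1/2) : ℝ)) t) (t : ℝ) (ht : 0 < t) :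
    0 < f t ∧ f t / 2 < (1 + 2 * f t ^ 2) ^ (-(1/2) : ℝ) * t := by
  have hpos : ∀ t, 0 < 1 + 2 * f t ^ 2 := fun t => by positivity
  have hmono : StrictMono f := by
    apply strictMono_of_deriv_pos
    intro x
    rw [(hf x).deriv]
    exact Real.rpow_pos_of_pos (hpos x) _
  have hft : 0 < f t := by rw [← hf0]; exact hmono ht
  refine ⟨hft, ?_⟩
  have hr : ∀ t, (1 + 2 * f t ^ 2) ^ (-(1/2) : ℝ) = (Real.sqrt (1 + 2 * f t ^ 2))⁻¹ := by
    intro t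
    rw [Real.rpow_neg (hpos t).le, Real.sqrt_eq_rpow]
  have hK : ∀ x, HasDerivAt (fun x => 2 * x - f x * Real.sqrt (1 + 2 * f x ^ 2))
      (2 - (1 + 2 * f x ^ 2 / (1 + 2 * f x ^ 2))) x := by
    intro x
    have h1 := hf x
    rw [hr] at h1
    have h2 : HasDerivAt (fun x => 1 + 2 * f x ^ 2)
       (2 * (2 * f x * (Real.sqrt (1 + 2 * f x ^ 2))⁻¹)) x := by
      have := ((h1.pow 2).const_mul 2).const_add 1
      simpa using this
    have h3 := h2.sqrt (hpos x).ne'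
    have h4 := ((hasDerivAt_id x).const_mul 2).sub (h1.mul h3)
    refine HasDerivAt.congr_deriv h4 ?_
    have hs : Real.sqrt (1 + 2 * f x ^ 2) ^ 2 = 1 + 2 * f x ^ 2 := Real.sq_sqrt (hpos x).le
    have hs0 : 0 < Real.sqrt (1 + 2 * f x ^ 2) := Real.sqrt_pos.2 (hpos x)
    generalize Real.sqrt (1 + 2 * f x ^ 2) = S at hs hs0
    rw [← hs]
    field_simp
  have hKm : StrictMono (fun x => 2 * x - f x * Real.sqrt (1 + 2 * f x ^ 2)) := by
    apply strictMono_of_deriv_pos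
    intro x
    rw [(hK x).deriv]
    have : 2 * f x ^ 2 / (1 + 2 * f x ^ 2) < 1 := by
      rw [div_lt_one (hpos x)]; linarith
    linarith
  have h5 := hKm ht
  simp only [hf0] at h5
  have hs0 : 0 < Real.sqrt (1 + 2 * f t ^ 2) := Real.sqrt_pos.2 (hpos t)
  rw [hr, inv_mul_eq_div, lt_div_iff₀ hs0]
  linarith

/-- Strict form of the key inequality for the change of variable. -/
theorem f_strict (f : ℝ → ℝ) (hf0 : f 0 = 0) (hodd : ∀ t : ℝ, f (-t) = -f t)
    (hf : ∀ t : ℝ, HasDerivAt f ((1 + 2 * f t ^ 2) ^ (-(1/2) : ℝ)) t) (t : ℝ) (ht : t ≠ 0) :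
    0 < |f t| ∧ |f t| ^ 2 / 2 < f t * (1 + 2 * f t ^ 2) ^ (-(1/2) : ℝ) * t := by
  rcases lt_or_gt_of_ne ht with h | h
  · obtain ⟨h1, h2⟩ := f_strict_pos f hf0 hf (-t) (by linarith)
    rw [hodd] at h1 h2
    refine ⟨abs_pos.2 (by linarith), ?_⟩
    rw [neg_sq] at h2
    rw [sq_abs]
    nlinarith
  · obtain ⟨h1, h2⟩ := f_strict_pos f hf0 hf t h
    refine ⟨abs_pos.2 h1.ne', ?_⟩
    rw [sq_abs]
    nlinarith

/-- cutoff derivative -/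
noncomputable def kk (n : ℕ) (u : ℝ) : ℝ := min 1 (max 0 (n * |u| - 1))

noncomputable def hh (n : ℕ) (t : ℝ) : ℝ := ∫ u in (0:ℝ)..t, kk n u

theorem kk_cont (n : ℕ) : Continuous (kk n) := by unfold kk; fun_prop

theorem kk_nonneg (n : ℕ) (u : ℝ) : 0 ≤ kk n u := by unfold kk; positivity

theorem kk_le (n : ℕ) (u : ℝ) : kk n u ≤ 1 := min_le_left _ _

theorem kk_zero (n : ℕ) (u : ℝ) (h : n * |u| ≤ 1) : kk n u = 0 := by
  unfold kk
  rw [max_eq_left (by linarith)]; simp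

theorem kk_tendsto (u : ℝ) (hu : u ≠ 0) : Tendsto (fun n => kk n u) atTop (𝓝 1) := by
  apply tendsto_const_nhds.congr'
  obtain ⟨m, hm⟩ := exists_nat_gt (2 / |u|)
  filter_upwards [eventually_ge_atTop m] with n hn
  have h1 : (m:ℝ) ≤ n := by exact_mod_cast hn
  have h0 : 0 < |u| := abs_pos.2 hu
  have : 2 ≤ n * |u| := by
    have : 2 / |u| ≤ n := by linarith
    rwa [div_le_iff₀ h0] at this
  unfold kk
  rw [min_eq_left]
  exact le_max_of_le_right (by linarith)

theorem hh_deriv (n : ℕ) (t : ℝ) : HasDerivAt (hh n) (kk n t) t :=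
  (kk_cont n).integral_hasStrictDerivAt 0 t |>.hasDerivAt

theorem hh_cont (n : ℕ) : Continuous (hh n) :=
  continuous_iff_continuousAt.2 fun t => (hh_deriv n t).continuousAt

theorem hh_zero (n : ℕ) (t : ℝ) (h : n * |t| ≤ 1) : hh n t = 0 := by
  unfold hh
  rw [intervalIntegral.integral_congr (g := fun _ => 0)]
  · simp
  · intro u hu
    apply kk_zero
    refine le_trans ?_ h
    have : |u| ≤ |t| := by
      have := Set.abs_sub_left_of_mem_uIcc hu
      simpa using this
    gcongr

theorem hh_abs (n : ℕ) (t : ℝ) : |hh n t| ≤ |t| := by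
  have := intervalIntegral.norm_integral_le_of_norm_le_const (a := 0) (b := t) (f := kk n) (C := 1)
    (fun u _ => by rw [Real.norm_eq_abs, abs_of_nonneg (kk_nonneg n u)]; exact kk_le n u)
  simpa [hh] using this

theorem hh_tendsto (t : ℝ) : Tendsto (fun n => hh n t) atTop (𝓝 t) := by
  have h : Tendsto (fun n => hh n t) atTop (𝓝 (∫ u in (0:ℝ)..t, (1:ℝ))) := by
    apply intervalIntegral.tendsto_integral_filter_of_dominated_convergence (fun _ => 1)
    · exact Eventually.of_forall fun n => (kk_cont n).aestronglyMeasurable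
    · refine Eventually.of_forall fun n => Eventually.of_forall fun u _ => ?_
      rw [Real.norm_eq_abs, abs_of_nonneg (kk_nonneg n u)]; exact kk_le n u
    · exact intervalIntegrable_const
    · have : ∀ᵐ u : ℝ, u ≠ 0 := by
        simp [ae_iff]
      filter_upwards [this] with u hu _
      exact kk_tendsto u hu
  simpa using h

end helpers

section pde
open Set Filter Topology

variable {N : ℕ}


theorem grad_bound (Ω : Set (EuclideanSpace ℝ (Fin N))) (hΩo : IsOpen Ω) (hΩb : Bornology.IsBounded Ω) (v : EuclideanSpace ℝ (Fin N) → ℝ)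
    (hreg2 : ContDiffOn ℝ 1 v (closure Ω)) :
    ∃ L : ℝ, 0 ≤ L ∧ ∀ x ∈ Ω, ‖fderiv ℝ v x‖ ≤ L := by
  have hK : IsCompact (closure Ω) := hΩb.isCompact_closure
  have key : ∃ L : ℝ, ∀ x ∈ closure Ω, x ∈ Ω → ‖fderiv ℝ v x‖ ≤ L := by
    refine hK.induction_on (p := fun s => ∃ L : ℝ, ∀ x ∈ s, x ∈ Ω → ‖fderiv ℝ v x‖ ≤ L) ?_ ?_ ?_ ?_
    · exact ⟨0, by simp⟩
    · rintro s t hst ⟨L, hL⟩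
      exact ⟨L, fun x hx => hL x (hst hx)⟩
    · rintro s t ⟨L, hL⟩ ⟨M, hM⟩
      refine ⟨max L M, fun x hx hx' => ?_⟩
      rcases hx with hx | hx
      · exact (hL x hx hx').trans (le_max_left _ _)
      · exact (hM x hx hx').trans (le_max_right _ _)
    · intro x hx
      have h1 := hreg2 x hx
      have h2 : ContDiffWithinAt ℝ (0 + 1) v (closure Ω) x := by simpa using h1
      rw [contDiffWithinAt_succ_iff_hasFDerivWithinAt' (by simp)] at h2
      obtain ⟨u, hu, -, -, f', hf', hc⟩ := h2
      rw [insert_eq_of_mem hx] at hu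
      have hc' : Tendsto (fun y => ‖f' y‖) (𝓝[closure Ω] x) (𝓝 ‖f' x‖) :=
        hc.continuousWithinAt.norm
      have h3 : {y | ‖f' y‖ < ‖f' x‖ + 1} ∈ 𝓝[closure Ω] x :=
        hc'.eventually (gt_mem_nhds (by linarith))
      refine ⟨u ∩ {y | ‖f' y‖ < ‖f' x‖ + 1}, inter_mem hu h3, ‖f' x‖ + 1, ?_⟩
      rintro y ⟨hy1, hy2⟩ hyΩ
      have h4 := (hf' y hy1).hasFDerivAt (mem_of_superset (hΩo.mem_nhds hyΩ) subset_closure)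
      rw [h4.fderiv]
      exact le_of_lt hy2
  obtain ⟨L, hL⟩ := key
  exact ⟨max L 0, le_max_right _ _, fun x hx => (hL x (subset_closure hx) hx).trans (le_max_left _ _)⟩

/-- Radial Lipschitz estimate for the zero extension. -/
theorem radial_lip (Ω : Set (EuclideanSpace ℝ (Fin N))) (hΩo : IsOpen Ω) 
    (hstar : StarConvex ℝ (0 : EuclideanSpace ℝ (Fin N)) Ω) (v : EuclideanSpace ℝ (Fin N) → ℝ) (hd : ∀ x ∈ Ω, DifferentiableAt ℝ v x)
    (w : EuclideanSpace ℝ (Fin N) → ℝ) (hw : Continuous w) (hwv : ∀ x ∈ Ω, w x = v x) (hw0 : ∀ x ∉ Ω, w x = 0)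
    (L R : ℝ) (hL0 : 0 ≤ L) (hL : ∀ x ∈ Ω, ‖fderiv ℝ v x‖ ≤ L) (hR : ∀ x ∈ Ω, ‖x‖ ≤ R)
    (x : EuclideanSpace ℝ (Fin N)) (hx : x ∈ Ω) (s : ℝ) (hs : 1 ≤ s) :
    |w (s • x) - w x| ≤ L * R * (s - 1) := by
  classical
  have hR0 : 0 ≤ R := (norm_nonneg _).trans (hR x hx)
  have key := norm_image_sub_le_of_norm_deriv_right_le_segment (f := fun t : ℝ => w (t • x))
    (f' := fun t => if t • x ∈ Ω then fderiv ℝ v (t • x) x else 0) (a := 1) (b := s) (C := L * R)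
    (by fun_prop) ?_ ?_ s ⟨hs, le_rfl⟩
  · simpa using key
  · intro t ht
    by_cases h : t • x ∈ Ω
    · simp only [h, if_true]
      have h1 : HasDerivAt (fun t : ℝ => t • x) x t := by
        simpa using (hasDerivAt_id t).smul_const x
      have h2 := (hd _ h).hasFDerivAt.comp_hasDerivAt t h1
      have h3 : (fun t : ℝ => w (t • x)) =ᶠ[𝓝 t] (v ∘ fun t : ℝ => t • x) := by
        have : ∀ᶠ y in 𝓝 t, y • x ∈ Ω :=
          (by fun_prop : Continuous fun t : ℝ => t • x).continuousAt.eventually (hΩo.mem_nhds h)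
        filter_upwards [this] with y hy using hwv _ hy
      exact (h2.congr_of_eventuallyEq h3).hasDerivWithinAt
    · simp only [h, if_false]
      have h3 : ∀ y ∈ Ici t, w (y • x) = 0 := by
        intro y hy
        apply hw0
        intro hyx
        apply h
        have hy0 : 0 < y := by have := ht.1; have := mem_Ici.1 hy; linarith
        have h5 := hstar.smul_mem hyx (t := t / y) (div_nonneg (by linarith [ht.1]) hy0.le)
          ((div_le_one hy0).2 hy)
        rwa [smul_smul, div_mul_cancel₀ _ hy0.ne'] at h5
      exact (hasDerivWithinAt_const t (Ici t) (0:ℝ)).congr h3 (h3 t self_mem_Ici)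
  · intro t ht
    split_ifs with h
    · calc _ ≤ ‖fderiv ℝ v (t • x)‖ * ‖x‖ := ContinuousLinearMap.le_opNorm _ _
        _ ≤ L * R := by gcongr; exact hL _ h; exact hR _ hx
    · simp; positivity

/-- Integral of a derivative vanishes. -/
theorem int_deriv_zero (F F' : EuclideanSpace ℝ (Fin N) → ℝ) (e : EuclideanSpace ℝ (Fin N)) (hF : Integrable F) (hF' : Integrable F')
    (h : ∀ x, HasLineDerivAt ℝ F (F' x) x e) : ∫ x, F' x = 0 := by
  have := integral_bilinear_hasLineDerivAt_right_eq_neg_left_of_integrable (μ := (volume : Measure (EuclideanSpace ℝ (Fin N))))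
    (f := fun _ : EuclideanSpace ℝ (Fin N) => (1:ℝ)) (f' := fun _ => (0:ℝ)) (g := F) (g' := F') (v := e)
    (B := ContinuousLinearMap.mul ℝ ℝ) (by simp) (by simpa using hF') (by simpa using hF)
    (fun x _ => by simpa using (hasFDerivAt_const (1:ℝ) x).hasLineDerivAt e) (fun x _ => h x)
  simpa using this

theorem cont_of_compact (U K : Set (EuclideanSpace ℝ (Fin N))) (hU : IsOpen U) (hK : IsCompact K) (hKU : K ⊆ U) (F : EuclideanSpace ℝ (Fin N) → ℝ)
    (hF : ContinuousOn F U) (h0 : ∀ x ∉ K, F x = 0) : Continuous F ∧ Integrable F := by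
  have hc : Continuous F := by
    rw [continuous_iff_continuousAt]
    intro x
    by_cases hx : x ∈ K
    · exact hF.continuousAt (hU.mem_nhds (hKU hx))
    · have : F =ᶠ[𝓝 x] fun _ => 0 := by
        filter_upwards [hK.isClosed.isOpen_compl.mem_nhds hx] with y hy using h0 y hy
      exact continuousAt_const.congr this.symm
  exact ⟨hc, hc.integrable_of_hasCompactSupport (HasCompactSupport.intro hK h0)⟩

theorem grad_ae_zero (hN : 0 < N) (Ω : Set (EuclideanSpace ℝ (Fin N))) (hΩo : IsOpen Ω) (v : EuclideanSpace ℝ (Fin N) → ℝ)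
    (hd : ∀ x ∈ Ω, DifferentiableAt ℝ v x)  (w : EuclideanSpace ℝ (Fin N) → ℝ) (hw : Continuous w)
    (hwv : ∀ x ∈ Ω, w x = v x) :
    ∀ᵐ x : EuclideanSpace ℝ (Fin N), x ∈ Ω → w x = 0 → fderiv ℝ v x = 0 := by
  set S : Set (EuclideanSpace ℝ (Fin N)) := Ω ∩ {x | w x = 0}
  have hS : MeasurableSet S := hΩo.measurableSet.inter (isClosed_eq hw continuous_const).measurableSet
  let e : EuclideanSpace ℝ (Fin N) := EuclideanSpace.single ⟨0, hN⟩ 1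
  have hA : ApproximatesLinearOn (fun x => v x • e) (0 : EuclideanSpace ℝ (Fin N) →L[ℝ] EuclideanSpace ℝ (Fin N)) S 0 := by
    intro x hx y hy
    have hx' : v x = 0 := (hwv x hx.1).symm.trans hx.2
    have hy' : v y = 0 := (hwv y hy.1).symm.trans hy.2
    simp [hx', hy']
  have h1 := hA.norm_fderiv_sub_le volume hS (fun x => (fderiv ℝ v x).smulRight e)
    (fun x hx => ((hd x hx.1).hasFDerivAt.smul_const e).hasFDerivWithinAt)
  rw [ae_restrict_iff' hS] at h1
  filter_upwards [h1] with x hx h2 h3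
  have h4 := hx ⟨h2, h3⟩
  have he : e ≠ 0 := by simp [e]
  simpa [he] using h4

/-- The data of the boundary value problem, with `w` the extension of `v` by zero. -/
structure Setup (Ω : Set (EuclideanSpace ℝ (Fin N))) (v w : EuclideanSpace ℝ (Fin N) → ℝ) (g : ℝ → ℝ) (L R : ℝ) : Prop where
  ho : IsOpen Ω
  hb : Bornology.IsBounded Ω
  hstar : StarConvex ℝ (0 : EuclideanSpace ℝ (Fin N)) Ω
  hreg : ContDiffOn ℝ 2 v Ω
  hw : Continuous w
  hwv : ∀ x ∈ Ω, w x = v x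
  hw0 : ∀ x ∉ Ω, w x = 0
  hL0 : 0 ≤ L
  hL : ∀ x ∈ Ω, ‖fderiv ℝ v x‖ ≤ L
  hR : ∀ x ∈ Ω, ‖x‖ ≤ R
  hg : Continuous g
  hpde : ∀ x ∈ Ω, -(∑ i : Fin N,
          fderiv ℝ (fun y => fderiv ℝ v y (EuclideanSpace.single i 1)) x
            (EuclideanSpace.single i 1)) = g (w x)

/-- partial derivative -/
noncomputable def dd (v : EuclideanSpace ℝ (Fin N) → ℝ) (i : Fin N) (x : EuclideanSpace ℝ (Fin N)) : ℝ := fderiv ℝ v x (EuclideanSpace.single i 1)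

/-- partial derivative, cut off on the zero set -/
noncomputable def qq (v w : EuclideanSpace ℝ (Fin N) → ℝ) (i : Fin N) (x : EuclideanSpace ℝ (Fin N)) : ℝ := if w x = 0 then 0 else dd v i x

namespace Setup
variable {Ω : Set (EuclideanSpace ℝ (Fin N))} {v w : EuclideanSpace ℝ (Fin N) → ℝ} {g : ℝ → ℝ} {L R : ℝ}

theorem mem_of_smul (H : Setup Ω v w g L R) {s : ℝ} (hs : 1 ≤ s) {x : EuclideanSpace ℝ (Fin N)} (h : s • x ∈ Ω) :
    x ∈ Ω := by
  have hs0 : 0 < s := by linarith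
  have h5 := H.hstar.smul_mem h (t := s⁻¹) (by positivity) (inv_le_one_of_one_le₀ hs)
  rwa [smul_smul, inv_mul_cancel₀ hs0.ne', one_smul] at h5

theorem mem_of_ne (H : Setup Ω v w g L R) {x : EuclideanSpace ℝ (Fin N)} (h : w x ≠ 0) : x ∈ Ω := by
  by_contra hx
  exact h (H.hw0 x hx)

theorem diff (H : Setup Ω v w g L R) : ∀ x ∈ Ω, DifferentiableAt ℝ v x := fun x hx =>
  ((H.hreg.differentiableOn (by norm_num)) x hx).differentiableAt (H.ho.mem_nhds hx)

theorem dd_contDiff (H : Setup Ω v w g L R) (i : Fin N) : ContDiffOn ℝ 1 (dd v i) Ω := by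
  have h1 : ContDiffOn ℝ 1 (fderiv ℝ v) Ω := H.hreg.fderiv_of_isOpen H.ho (by norm_num)
  exact h1.clm_apply contDiffOn_const

theorem dd_bound (H : Setup Ω v w g L R) (i : Fin N) (x : EuclideanSpace ℝ (Fin N)) (hx : x ∈ Ω) : |dd v i x| ≤ L := by
  have := (fderiv ℝ v x).le_opNorm (EuclideanSpace.single i (1:ℝ))
  simp only [PiLp.norm_single, norm_one, mul_one] at this
  exact this.trans (H.hL x hx)

theorem compactK (H : Setup Ω v w g L R) (n : ℕ) {s : ℝ} (hs : 1 ≤ s) :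
    IsCompact {x : EuclideanSpace ℝ (Fin N) | 1 ≤ n * |w (s • x)|} ∧
    {x : EuclideanSpace ℝ (Fin N) | 1 ≤ n * |w (s • x)|} ⊆ Ω ∩ {x | s • x ∈ Ω} := by
  have hw := H.hw
  have hsub : {x : EuclideanSpace ℝ (Fin N) | 1 ≤ n * |w (s • x)|} ⊆ Ω ∩ {x | s • x ∈ Ω} := by
    intro x hx
    have h1 : w (s • x) ≠ 0 := by
      intro h0
      simp only [mem_ofPred_eq, h0, abs_zero, mul_zero] at hx
      linarith
    have h2 := H.mem_of_ne h1
    exact ⟨H.mem_of_smul hs h2, h2⟩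
  refine ⟨?_, hsub⟩
  apply Metric.isCompact_of_isClosed_isBounded
  · exact isClosed_le continuous_const (by fun_prop)
  · exact H.hb.subset (hsub.trans inter_subset_left)

theorem openU (H : Setup Ω v w g L R) (s : ℝ) : IsOpen (Ω ∩ {x | s • x ∈ Ω}) :=
  H.ho.inter (H.ho.preimage (continuous_const_smul s))

theorem contA (H : Setup Ω v w g L R) (n : ℕ) {s : ℝ} (hs : 1 ≤ s) (i : Fin N) :
    Continuous (fun x => kk n (w (s • x)) * (s * dd v i (s • x)) * dd v i x) ∧
    Integrable (fun x => kk n (w (s • x)) * (s * dd v i (s • x)) * dd v i x) := by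
  have hd := (H.dd_contDiff i).continuousOn
  have hk := kk_cont n
  have hw := H.hw
  refine cont_of_compact _ _ (H.openU s) (H.compactK n hs).1 (H.compactK n hs).2 _ ?_ ?_
  · have h1 : ContinuousOn (fun x : EuclideanSpace ℝ (Fin N) => dd v i (s • x)) (Ω ∩ {x | s • x ∈ Ω}) :=
      hd.comp (continuous_const_smul s).continuousOn (fun x hx => hx.2)
    have h2 : ContinuousOn (fun x : EuclideanSpace ℝ (Fin N) => dd v i x) (Ω ∩ {x | s • x ∈ Ω}) := hd.mono inter_subset_left
    have h3 : Continuous (fun x : EuclideanSpace ℝ (Fin N) => kk n (w (s • x))) := by fun_prop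
    exact (h3.continuousOn.mul (continuousOn_const.mul h1)).mul h2
  · intro x hx
    have hx' : n * |w (s • x)| ≤ 1 := le_of_lt (by simpa using hx)
    simp [kk_zero n _ hx']

theorem contB (H : Setup Ω v w g L R) (n : ℕ) {s : ℝ} (hs : 1 ≤ s) (i : Fin N) :
    Integrable (fun x => hh n (w (s • x)) *
      fderiv ℝ (dd v i) x (EuclideanSpace.single i 1)) := by
  have hd : ContinuousOn (fderiv ℝ (dd v i)) Ω :=
    (H.dd_contDiff i).continuousOn_fderiv_of_isOpen H.ho (by norm_num)
  have hk := hh_cont n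
  have hw := H.hw
  refine (cont_of_compact _ _ (H.openU s) (H.compactK n hs).1 (H.compactK n hs).2 _ ?_ ?_).2
  · have h3 : Continuous (fun x : EuclideanSpace ℝ (Fin N) => hh n (w (s • x))) := by fun_prop
    exact h3.continuousOn.mul ((hd.mono inter_subset_left).clm_apply continuousOn_const)
  · intro x hx
    have hx' : n * |w (s • x)| ≤ 1 := le_of_lt (by simpa using hx)
    simp [hh_zero n _ hx']

theorem contF (H : Setup Ω v w g L R) (n : ℕ) {s : ℝ} (hs : 1 ≤ s) (i : Fin N) :
    Integrable (fun x => hh n (w (s • x)) * dd v i x) := by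
  have hd := (H.dd_contDiff i).continuousOn
  have hk := hh_cont n
  have hw := H.hw
  refine (cont_of_compact _ _ (H.openU s) (H.compactK n hs).1 (H.compactK n hs).2 _ ?_ ?_).2
  · have h3 : Continuous (fun x : EuclideanSpace ℝ (Fin N) => hh n (w (s • x))) := by fun_prop
    exact h3.continuousOn.mul (hd.mono inter_subset_left)
  · intro x hx
    have hx' : n * |w (s • x)| ≤ 1 := le_of_lt (by simpa using hx)
    simp [hh_zero n _ hx']

theorem lineDeriv (H : Setup Ω v w g L R) (n : ℕ) {s : ℝ} (hs : 1 ≤ s) (i : Fin N) (x : EuclideanSpace ℝ (Fin N)) :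
    HasLineDerivAt ℝ (fun x => hh n (w (s • x)) * dd v i x)
      (kk n (w (s • x)) * (s * dd v i (s • x)) * dd v i x + hh n (w (s • x)) *
      fderiv ℝ (dd v i) x (EuclideanSpace.single i 1)) x (EuclideanSpace.single i 1) := by
  obtain ⟨hK, hKU⟩ := H.compactK n hs
  by_cases hx : x ∈ {x : EuclideanSpace ℝ (Fin N) | 1 ≤ n * |w (s • x)|}
  · obtain ⟨h1, h2⟩ := hKU hx
    have h2 : s • x ∈ Ω := h2
    have hw1 : HasFDerivAt w (fderiv ℝ v (s • x)) (s • x) := by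
      apply (H.diff _ h2).hasFDerivAt.congr_of_eventuallyEq
      filter_upwards [H.ho.mem_nhds h2] with y hy using H.hwv y hy
    have hsm : HasFDerivAt (fun x : EuclideanSpace ℝ (Fin N) => s • x) (s • ContinuousLinearMap.id ℝ (EuclideanSpace ℝ (Fin N))) x :=
      (hasFDerivAt_id x).const_smul s
    have hw2 := hw1.comp x hsm
    have hw3 := (hh_deriv n (w (s • x))).comp_hasFDerivAt x hw2
    have hdd : HasFDerivAt (dd v i) (fderiv ℝ (dd v i) x) x :=
      (((H.dd_contDiff i).differentiableOn (by norm_num)) x h1).differentiableAt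
        (H.ho.mem_nhds h1) |>.hasFDerivAt
    have h4 := (hw3.mul hdd).hasLineDerivAt (EuclideanSpace.single i 1)
    refine HasDerivAt.congr_deriv h4 ?_
    simp [dd]
    ring
  · have hx' : n * |w (s • x)| ≤ 1 := le_of_lt (by simpa using hx)
    rw [kk_zero n _ hx', hh_zero n _ hx']
    have : (fun x => hh n (w (s • x)) * dd v i x) =ᶠ[𝓝 x] fun _ => 0 := by
      filter_upwards [hK.isClosed.isOpen_compl.mem_nhds hx] with y hy
      have hy' : n * |w (s • y)| ≤ 1 := le_of_lt (by simpa using hy)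
      simp [hh_zero n _ hy']
    have h5 := ((hasFDerivAt_const (𝕜 := ℝ) (0:ℝ) x).congr_of_eventuallyEq this).hasLineDerivAt
      (EuclideanSpace.single i 1)
    simpa using h5

theorem weak_n (H : Setup Ω v w g L R) (n : ℕ) {s : ℝ} (hs : 1 ≤ s) :
    ∑ i : Fin N, ∫ x, kk n (w (s • x)) * (s * dd v i (s • x)) * dd v i x =
      ∫ x, hh n (w (s • x)) * g (w x) := by
  have h1 : ∀ i : Fin N, ∫ x, kk n (w (s • x)) * (s * dd v i (s • x)) * dd v i x =
      - ∫ x, hh n (w (s • x)) * fderiv ℝ (dd v i) x (EuclideanSpace.single i 1) := by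
    intro i
    have h := int_deriv_zero _ _ _ (H.contF n hs i) ((H.contA n hs i).2.add (H.contB n hs i))
      (H.lineDeriv n hs i)
    have h' := integral_add (H.contA n hs i).2 (H.contB n hs i)
    simp only [Pi.add_apply] at h
    linarith
  rw [Finset.sum_congr rfl fun i _ => h1 i, Finset.sum_neg_distrib,
    ← integral_finsetSum _ fun i _ => H.contB n hs i, ← integral_neg]
  congr 1
  funext x
  by_cases hx : x ∈ Ω
  · rw [← H.hpde x hx, ← Finset.mul_sum]
    simp only [mul_neg]
    rfl
  · have hx' : w (s • x) = 0 := H.hw0 _ fun h => hx (H.mem_of_smul hs h)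
    rw [hx', hh_zero n 0 (by simp)]
    simp

theorem cs (H : Setup Ω v w g L R) : HasCompactSupport w :=
  HasCompactSupport.intro H.hb.isCompact_closure fun x hx => H.hw0 x fun h => hx (subset_closure h)

theorem integ_of_bdd (H : Setup Ω v w g L R) (F : EuclideanSpace ℝ (Fin N) → ℝ)
    (hF : Measurable F) (C : ℝ)
    (hC : ∀ x ∈ Ω, |F x| ≤ C) (h0 : ∀ x ∉ Ω, F x = 0) : Integrable F := by
  have hi : Integrable (Ω.indicator fun _ => C) := by
    rw [integrable_indicator_iff H.ho.measurableSet]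
    exact integrableOn_const (H.hb.measure_lt_top).ne
  refine hi.mono' hF.aestronglyMeasurable (Eventually.of_forall fun x => ?_)
  by_cases hx : x ∈ Ω
  · simpa [hx] using hC x hx
  · simp [hx, h0 x hx]

theorem qq_meas (H : Setup Ω v w g L R) (i : Fin N) : Measurable (qq v w i) := by
  have hc : ∀ n : ℕ, Measurable (fun x => kk n (w x) * dd v i x) := by
    intro n
    obtain ⟨h1, h2⟩ := H.compactK n (le_refl 1)
    have hw := H.hw
    have hk := kk_cont n
    refine (cont_of_compact _ _ H.ho h1 (h2.trans inter_subset_left) _ ?_ ?_).1.measurable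
    · have h3 : Continuous (fun x => kk n (w x)) := by fun_prop
      exact h3.continuousOn.mul (H.dd_contDiff i).continuousOn
    · intro x hx
      have hx' : n * |w x| ≤ 1 := le_of_lt (by simpa using hx)
      simp [kk_zero n _ hx']
  refine measurable_of_tendsto_metrizable hc ?_
  rw [tendsto_pi_nhds]
  intro x
  by_cases hx : w x = 0
  · simp [qq, hx, kk_zero]
  · simpa [qq, hx] using (kk_tendsto _ hx).mul_const (dd v i x)

theorem qq_zero (H : Setup Ω v w g L R) (i : Fin N) (x : EuclideanSpace ℝ (Fin N)) (hx : x ∉ Ω) :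
    qq v w i x = 0 := by simp [qq, H.hw0 x hx]

theorem qq_bound (H : Setup Ω v w g L R) (i : Fin N) (x : EuclideanSpace ℝ (Fin N)) :
    |qq v w i x| ≤ L := by
  by_cases hx : w x = 0
  · simp [qq, hx, H.hL0]
  · simp only [qq, hx, if_false]
    exact H.dd_bound i x (H.mem_of_ne hx)

theorem weak (H : Setup Ω v w g L R) {s : ℝ} (hs : 1 ≤ s) :
    ∑ i : Fin N, ∫ x, (s * qq v w i (s • x)) * dd v i x = ∫ x, w (s • x) * g (w x) := by
  have hw := H.hw
  have hg := H.hg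
  have h1 : Tendsto (fun n : ℕ => ∑ i : Fin N, ∫ x, kk n (w (s • x)) * (s * dd v i (s • x)) * dd v i x)
      atTop (𝓝 (∑ i : Fin N, ∫ x, (s * qq v w i (s • x)) * dd v i x)) := by
    refine tendsto_finsetSum _ fun i _ => ?_
    have hi : Integrable (Ω.indicator fun _ => 1 * (s * L) * L) := by
      rw [integrable_indicator_iff H.ho.measurableSet]
      exact integrableOn_const (H.hb.measure_lt_top).ne
    refine tendsto_integral_of_dominated_convergence _
      (fun n => (H.contA n hs i).1.aestronglyMeasurable) hi ?_ ?_
    · intro n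
      refine Eventually.of_forall fun x => ?_
      have hL0 := H.hL0
      by_cases h0 : w (s • x) = 0
      · rw [h0, kk_zero n 0 (by simp)]
        simp only [zero_mul, norm_zero]
        exact indicator_nonneg (fun _ _ => by positivity) _
      · have h2 := H.mem_of_ne h0
        have h3 := H.mem_of_smul hs h2
        rw [indicator_of_mem h3, norm_mul, norm_mul, norm_mul]
        simp only [Real.norm_eq_abs]
        rw [abs_of_nonneg (kk_nonneg n _), abs_of_nonneg (by linarith : 0 ≤ s)]
        gcongr
        · exact kk_le n _
        · exact H.dd_bound i _ h2
        · exact H.dd_bound i _ h3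
    · refine Eventually.of_forall fun x => ?_
      by_cases h0 : w (s • x) = 0
      · simp [qq, h0, kk_zero]
      · simp only [qq, h0, if_false]
        simpa using ((kk_tendsto _ h0).mul_const (s * dd v i (s • x))).mul_const (dd v i x)
  have h2 : Tendsto (fun n : ℕ => ∫ x, hh n (w (s • x)) * g (w x)) atTop
      (𝓝 (∫ x, w (s • x) * g (w x))) := by
    have hcs : HasCompactSupport (fun x => |w (s • x)| * |g (w x)|) := by
      refine HasCompactSupport.intro H.hb.isCompact_closure fun x hx => ?_
      rw [H.hw0 (s • x) fun h => hx (subset_closure (H.mem_of_smul hs h))]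
      simp
    refine tendsto_integral_of_dominated_convergence (fun x => |w (s • x)| * |g (w x)|) ?_ ?_ ?_ ?_
    · intro n
      have := hh_cont n
      exact Continuous.aestronglyMeasurable (by fun_prop)
    · exact Continuous.integrable_of_hasCompactSupport (by fun_prop) hcs
    · intro n
      refine Eventually.of_forall fun x => ?_
      rw [norm_mul, Real.norm_eq_abs, Real.norm_eq_abs]
      exact mul_le_mul_of_nonneg_right (hh_abs n _) (abs_nonneg _)
    · exact Eventually.of_forall fun x => (hh_tendsto _).mul_const _
  refine tendsto_nhds_unique h1 (h2.congr fun n => ?_)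
  exact (H.weak_n n hs).symm

theorem weak' (H : Setup Ω v w g L R) (hN : 0 < N) {s : ℝ} (hs : 1 ≤ s) :
    ∑ i : Fin N, ∫ x, (s * qq v w i (s • x)) * qq v w i x = ∫ x, w (s • x) * g (w x) := by
  rw [← H.weak hs]
  refine Finset.sum_congr rfl fun i _ => integral_congr_ae ?_
  filter_upwards [grad_ae_zero hN Ω H.ho v H.diff w H.hw H.hwv] with x hx
  by_cases hxΩ : x ∈ Ω
  · by_cases h0 : w x = 0
    · simp [qq, h0, dd, hx hxΩ h0]
    · simp [qq, h0]
  · rw [H.qq_zero i (s • x) fun h => hxΩ (H.mem_of_smul hs h)]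
    simp

theorem energy (H : Setup Ω v w g L R) (hN : 0 < N) {s : ℝ} (hs : 1 ≤ s) :
    2 * ∫ x, w (s • x) * g (w x) ≤ (s ^ 2 * (s ^ N)⁻¹ + 1) * ∫ x, w x * g (w x) := by
  have hs0 : 0 < s := by linarith
  have hm := H.qq_meas
  have hD := H.weak' hN (le_refl 1)
  simp only [one_smul, one_mul] at hD
  have hi1 : ∀ i, Integrable (fun x => (s * qq v w i (s • x)) * qq v w i x) := fun i =>
    H.integ_of_bdd _ (by have := hm i; fun_prop) (s * L * L) (fun x _ => by
      rw [abs_mul, abs_mul, abs_of_pos hs0]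
      have := H.hL0
      gcongr
      · exact H.qq_bound i _
      · exact H.qq_bound i _) (fun x hx => by rw [H.qq_zero i x hx]; simp)
  have hi2 : ∀ i, Integrable (fun x => qq v w i x * qq v w i x) := fun i =>
    H.integ_of_bdd _ (by have := hm i; fun_prop) (L * L) (fun x _ => by
      rw [abs_mul]
      have := H.hL0
      gcongr
      · exact H.qq_bound i _
      · exact H.qq_bound i _) (fun x hx => by rw [H.qq_zero i x hx]; simp)
  have hi3 : ∀ i, Integrable (fun x => qq v w i (s • x) * qq v w i (s • x)) := fun i =>
    (hi2 i).comp_smul hs0.ne'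
  have hsc : ∀ i, ∫ x, qq v w i (s • x) * qq v w i (s • x) =
      (s ^ N)⁻¹ * ∫ x, qq v w i x * qq v w i x := by
    intro i
    have := Measure.integral_comp_smul (volume : Measure (EuclideanSpace ℝ (Fin N)))
      (fun x => qq v w i x * qq v w i x) s
    rw [this, finrank_euclideanSpace, Fintype.card_fin, abs_of_pos (by positivity), smul_eq_mul]
  have hpos : ∀ i, 2 * ∫ x, (s * qq v w i (s • x)) * qq v w i x ≤
      (s ^ 2 * (s ^ N)⁻¹ + 1) * ∫ x, qq v w i x * qq v w i x := by
    intro i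
    have h0 : 0 ≤ ∫ x, (s * qq v w i (s • x) - qq v w i x) ^ 2 :=
      integral_nonneg fun x => sq_nonneg _
    have h1 : ∫ x, (s * qq v w i (s • x) - qq v w i x) ^ 2 =
        ∫ x, ((s ^ 2 * (qq v w i (s • x) * qq v w i (s • x)) +  (qq v w i x * qq v w i x)) -
          2 * ((s * qq v w i (s • x)) * qq v w i x)) := by
      congr 1; funext x; ring
    have i4 : Integrable (fun x => s ^ 2 * (qq v w i (s • x) * qq v w i (s • x)) +
        (qq v w i x * qq v w i x)) := ((hi3 i).const_mul _).add (hi2 i)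
    rw [h1, integral_sub i4 ((hi1 i).const_mul _),
      integral_add ((hi3 i).const_mul _) (hi2 i), integral_const_mul, integral_const_mul, hsc] at h0
    linarith
  rw [← H.weak' hN hs, ← hD, Finset.mul_sum, Finset.mul_sum]
  exact Finset.sum_le_sum fun i _ => hpos i

theorem rem_tendsto (H : Setup Ω v w g L R) (G : ℝ → ℝ) (hG : ∀ t, HasDerivAt G (g t) t) :
    Tendsto (fun s : ℝ => ∫ x, (G (w (s • x)) - G (w x) - (w (s • x) - w x) * g (w x)) / (s - 1))
      (𝓝[>] 1) (𝓝 0) := by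
  have hw := H.hw
  have hg := H.hg
  have hGc : Continuous G := continuous_iff_continuousAt.2 fun t => (hG t).continuousAt
  obtain ⟨B, hB⟩ := H.cs.exists_bound_of_continuous hw
  obtain ⟨M, hM⟩ := (isCompact_Icc (a := -B) (b := B)).exists_bound_of_continuousOn hg.continuousOn
  have hmem : ∀ x, w x ∈ Icc (-B) B := fun x => abs_le.1 (hB x)
  have hM0 : 0 ≤ M := (norm_nonneg _).trans (hM _ (hmem 0))
  have hlip := radial_lip Ω H.ho H.hstar v H.diff w hw H.hwv H.hw0 L R H.hL0 H.hL H.hR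
  have hi : Integrable (Ω.indicator fun _ => 2 * M * (L * R)) := by
    rw [integrable_indicator_iff H.ho.measurableSet]
    exact integrableOn_const (H.hb.measure_lt_top).ne
  have := tendsto_integral_filter_of_dominated_convergence (μ := volume) (l := 𝓝[>] (1:ℝ))
    (F := fun (s : ℝ) x => (G (w (s • x)) - G (w x) - (w (s • x) - w x) * g (w x)) / (s - 1))
    (f := fun _ => 0) (Ω.indicator fun _ => 2 * M * (L * R)) ?_ ?_ hi ?_
  · simpa using this
  · exact Eventually.of_forall fun s => Continuous.aestronglyMeasurable (by fun_prop)
  · filter_upwards [self_mem_nhdsWithin] with s hs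
    have hs' : 0 < s - 1 := sub_pos.2 hs
    refine Eventually.of_forall fun x => ?_
    by_cases hx : x ∈ Ω
    · rw [indicator_of_mem hx, norm_div, Real.norm_of_nonneg hs'.le, div_le_iff₀ hs']
      have h1 := Convex.norm_image_sub_le_of_norm_hasDerivWithin_le (s := Icc (-B) B)
        (f := fun t => G t - t * g (w x)) (f' := fun t => g t - g (w x)) (C := 2 * M)
        (fun t _ => (HasDerivAt.congr_deriv ((hG t).sub ((hasDerivAt_id t).mul_const (g (w x))))
          (by simp)).hasDerivWithinAt)
        (fun t ht => (norm_sub_le _ _).trans (by linarith [hM t ht, hM _ (hmem x)]))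
        (convex_Icc _ _) (hmem x) (hmem (s • x))
      have h2 := hlip x hx s (le_of_lt hs)
      calc _ = ‖(G (w (s • x)) - w (s • x) * g (w x)) - (G (w x) - w x * g (w x))‖ := by
              congr 1; ring
        _ ≤ 2 * M * ‖w (s • x) - w x‖ := h1
        _ ≤ 2 * M * (L * R * (s - 1)) := by gcongr; exact h2
        _ = _ := by ring
    · rw [H.hw0 x hx, H.hw0 (s • x) fun h => hx (H.mem_of_smul (le_of_lt hs) h)]
      simp [hx]
  · refine Eventually.of_forall fun x => ?_
    by_cases hx : x ∈ Ω
    · have hT : Tendsto (fun s : ℝ => w (s • x)) (𝓝[>] 1) (𝓝 (w x)) := by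
        have : Continuous (fun s : ℝ => w (s • x)) := by fun_prop
        have h := (this.tendsto 1).mono_left (nhdsWithin_le_nhds (s := Ioi 1))
        simpa using h
      have h1 := (hG (w x)).isLittleO.comp_tendsto hT
      have h2 : (fun s : ℝ => w (s • x) - w x) =O[𝓝[>] 1] fun s => s - 1 := by
        refine Asymptotics.IsBigO.of_bound (L * R) ?_
        filter_upwards [self_mem_nhdsWithin] with s hs
        rw [Real.norm_of_nonneg (sub_pos.2 hs).le]
        exact hlip x hx s (le_of_lt hs)
      have h3 := (h1.trans_isBigO h2).tendsto_div_nhds_zero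
      simpa using h3
    · refine tendsto_const_nhds.congr' ?_
      filter_upwards [self_mem_nhdsWithin] with s hs
      rw [H.hw0 x hx, H.hw0 (s • x) fun h => hx (H.mem_of_smul (le_of_lt hs) h)]
      simp

theorem pohozaev (H : Setup Ω v w g L R) (hN : 0 < N) (G : ℝ → ℝ) (hG0 : G 0 = 0)
    (hG : ∀ t, HasDerivAt G (g t) t) :
    (N - 2 : ℝ) * ∫ x, w x * g (w x) ≤ 2 * N * ∫ x, G (w x) := by
  have hw := H.hw
  have hg := H.hg
  have hGc : Continuous G := continuous_iff_continuousAt.2 fun t => (hG t).continuousAt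
  set D := ∫ x, w x * g (w x) with hD
  set I := ∫ x, G (w x) with hI
  have iG : Integrable (fun x => G (w x)) := by
    refine Continuous.integrable_of_hasCompactSupport (by fun_prop) ?_
    refine HasCompactSupport.intro H.hb.isCompact_closure fun x hx => ?_
    rw [H.hw0 x fun h => hx (subset_closure h), hG0]
  have iD : Integrable (fun x => w x * g (w x)) := by
    refine Continuous.integrable_of_hasCompactSupport (by fun_prop) ?_
    refine HasCompactSupport.intro H.hb.isCompact_closure fun x hx => ?_
    rw [H.hw0 x fun h => hx (subset_closure h), zero_mul]
  have iW : ∀ s : ℝ, 1 ≤ s → Integrable (fun x => w (s • x) * g (w x)) := by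
    intro s hs
    refine Continuous.integrable_of_hasCompactSupport (by fun_prop) ?_
    refine HasCompactSupport.intro H.hb.isCompact_closure fun x hx => ?_
    rw [H.hw0 (s • x) fun h => hx (subset_closure (H.mem_of_smul hs h)), zero_mul]
  let φ : ℝ → ℝ := fun s => 2 * (s ^ N)⁻¹ * I - s ^ 2 * (s ^ N)⁻¹ * D
  have hφ : HasDerivAt φ (-2 * N * I - (2 - N) * D) 1 := by
    have h1 : HasDerivAt (fun s : ℝ => (s ^ N)⁻¹) (-(N:ℝ)) 1 := by
      exact HasDerivAt.congr_deriv ((hasDerivAt_pow N (1:ℝ)).inv (by simp)) (by simp)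
    have h2 : HasDerivAt (fun s : ℝ => s ^ 2) (2:ℝ) 1 := by
      simpa using hasDerivAt_pow 2 (1:ℝ)
    refine HasDerivAt.congr_deriv (((h1.const_mul 2).mul_const I).sub ((h2.mul h1).mul_const D)) ?_
    simp only [one_pow, inv_one]
    ring
  have hslope : Tendsto (slope φ 1) (𝓝[>] 1) (𝓝 (-2 * N * I - (2 - N) * D)) :=
    (hasDerivAt_iff_tendsto_slope.1 hφ).mono_left (nhdsWithin_mono _ fun x hx => ne_of_gt hx)
  have hrem := (H.rem_tendsto G hG).const_mul 2
  rw [mul_zero] at hrem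
  have hle : -2 * N * I - (2 - N) * D ≤ 0 := by
    refine le_of_tendsto_of_tendsto hslope hrem ?_
    filter_upwards [self_mem_nhdsWithin] with s hs
    have hs1 : 1 < s := hs
    have hs0 : 0 < s := by linarith
    have hs' : 0 < s - 1 := by linarith
    have e1 : ∫ x, (G (w (s • x)) - G (w x) - (w (s • x) - w x) * g (w x)) =
        (s ^ N)⁻¹ * I - I - ((∫ x, w (s • x) * g (w x)) - D) := by
      have hsc := Measure.integral_comp_smul (volume : Measure (EuclideanSpace ℝ (Fin N)))
        (fun x => G (w x)) s
      rw [finrank_euclideanSpace, Fintype.card_fin, abs_of_pos (by positivity), smul_eq_mul] at hsc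
      have iGs : Integrable (fun x => G (w (s • x))) := iG.comp_smul hs0.ne'
      simp only [sub_mul]
      have i1 : Integrable (fun x => G (w (s • x)) - G (w x)) := iGs.sub iG
      have i2 : Integrable (fun x => w (s • x) * g (w x) - w x * g (w x)) := (iW s hs1.le).sub iD
      rw [integral_sub i1 i2, integral_sub iGs iG,
        integral_sub (iW s hs1.le) iD, hsc]
    rw [integral_div, e1, slope_def_field, ← mul_div_assoc]
    gcongr
    have := H.energy hN hs1.le
    simp only [φ, one_pow, inv_one]
    linarith
  linarith

end Setup

end pde

theorem stmt_19
    (N : ℕ) (hN : 3 ≤ N)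
    (Ω : Set (EuclideanSpace ℝ (Fin N)))
    (hΩo : IsOpen Ω) (hΩb : Bornology.IsBounded Ω)
    -- Ω is star-shaped (with respect to the origin)
    (hstar : StarConvex ℝ (0 : EuclideanSpace ℝ (Fin N)) Ω)
    (f : ℝ → ℝ) (hf0 : f 0 = 0) (hodd : ∀ t : ℝ, f (-t) = -f t)
    (hf1 : ∀ t : ℝ, 0 ≤ t → HasDerivAt f ((1 + 2 * f t ^ 2) ^ (-(1/2) : ℝ)) t)
    (v : EuclideanSpace ℝ (Fin N) → ℝ)
    -- regularity: v ∈ C²(Ω) ∩ C¹(Ω̄)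
    (hreg1 : ContDiffOn ℝ 2 v Ω)
    (hreg2 : ContDiffOn ℝ 1 v (closure Ω))
    -- boundary condition v = 0 on ∂Ω
    (hbd : ∀ x ∈ frontier Ω, v x = 0)
    -- the equation −Δv = |f(v)|^(2·2*−2) f(v) f'(v) in Ω
    (hpde : ∀ x ∈ Ω,
      -(∑ i : Fin N,
          fderiv ℝ (fun y => fderiv ℝ v y (EuclideanSpace.single i 1)) x
            (EuclideanSpace.single i 1))
        = |f (v x)| ^ (2 * (2 * (N:ℝ) / ((N:ℝ) - 2)) - 2) * f (v x) * deriv f (v x)) :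
    ∀ x ∈ Ω, v x = 0 := by 
  classical
  have hN3 : (3:ℝ) ≤ N := by exact_mod_cast hN
  have hN2 : (0:ℝ) < (N:ℝ) - 2 := by linarith
  obtain ⟨q, hq⟩ : ∃ q : ℝ, q = 2 * (2 * (N:ℝ) / ((N:ℝ) - 2)) - 2 := ⟨_, rfl⟩
  rw [← hq] at hpde
  have hq2 : q + 2 = 4 * N / ((N:ℝ) - 2) := by rw [hq]; ring
  have hq0 : 0 < q := by
    have : 2 < 4 * N / ((N:ℝ) - 2) := by rw [lt_div_iff₀ hN2]; linarith
    linarith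
  have hf := f_deriv_all f hodd hf1
  have hfc : Continuous f := continuous_iff_continuousAt.2 fun t => (hf t).continuousAt
  let f' : ℝ → ℝ := fun t => (1 + 2 * f t ^ 2) ^ (-(1/2) : ℝ)
  have hf'c : Continuous f' := by
    refine Continuous.rpow_const (by fun_prop) fun t => Or.inl ?_
    positivity
  let g : ℝ → ℝ := fun t => |f t| ^ q * f t * f' t
  have habs : ∀ r : ℝ, 0 < r → Continuous (fun t => |f t| ^ r) := fun r hr =>
    Continuous.rpow_const (by fun_prop) fun t => Or.inr hr.le
  have hgc : Continuous g := ((habs q hq0).mul hfc).mul hf'c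
  let G : ℝ → ℝ := fun t => |f t| ^ (q + 2) / (q + 2)
  have hG : ∀ t, HasDerivAt G (g t) t := by
    intro t
    have h1 := ((hasDerivAt_abs_rpow (f t) (p := q + 2) (by linarith)).comp t (hf t)).div_const (q + 2)
    refine HasDerivAt.congr_deriv h1 ?_
    have : q + 2 - 2 = q := by ring
    rw [this]
    have : q + 2 ≠ 0 := by linarith
    simp only [g, f']
    field_simp
  have hG0 : G 0 = 0 := by
    simp only [G, hf0, abs_zero]
    rw [Real.zero_rpow (by linarith), zero_div]
  obtain ⟨L, hL0, hL⟩ := grad_bound Ω hΩo hΩb v hreg2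
  obtain ⟨R, hR⟩ := hΩb.exists_norm_le
  let w : EuclideanSpace ℝ (Fin N) → ℝ := Ω.indicator v
  have hwv : ∀ x ∈ Ω, w x = v x := fun x hx => Set.indicator_of_mem hx v
  have hw0 : ∀ x ∉ Ω, w x = 0 := fun x hx => Set.indicator_of_notMem hx v
  have hw : Continuous w := continuous_indicator hbd hreg2.continuousOn
  have H : Setup Ω v w g L R :=
    { ho := hΩo, hb := hΩb, hstar := hstar, hreg := hreg1, hw := hw, hwv := hwv, hw0 := hw0,
      hL0 := hL0, hL := hL, hR := hR, hg := hgc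
      hpde := fun x hx => by
        rw [hpde x hx, hwv x hx, (hf (v x)).deriv] }
  have hP := H.pohozaev (by omega) G hG0 hG
  let ψ : ℝ → ℝ := fun t => t * g t - |f t| ^ (q + 2) / 2
  have hψc : Continuous ψ :=
    (continuous_id.mul hgc).sub ((habs (q + 2) (by linarith)).div_const 2)
  have hψ0 : ψ 0 = 0 := by
    simp only [ψ, hf0, abs_zero]
    rw [Real.zero_rpow (by linarith)]; simp
  have hψpos : ∀ t, t ≠ 0 → 0 < ψ t := by
    intro t ht
    obtain ⟨h1, h2⟩ := f_strict f hf0 hodd hf t ht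
    have h3 : |f t| ^ (q + 2) = |f t| ^ q * |f t| ^ 2 := by
      rw [Real.rpow_add h1]; norm_num
    have h4 : 0 < |f t| ^ q := Real.rpow_pos_of_pos h1 _
    have h5 : ψ t = |f t| ^ q * (f t * f' t * t - |f t| ^ 2 / 2) := by
      simp only [ψ, g, h3]; ring
    rw [h5]
    exact mul_pos h4 (sub_pos.2 h2)
  intro x hx
  by_contra hvx
  have hcs : ∀ F : ℝ → ℝ, F 0 = 0 → HasCompactSupport (fun x => F (w x)) := fun F hF =>
    HasCompactSupport.intro hΩb.isCompact_closure fun y hy => by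
      rw [hw0 y fun h => hy (subset_closure h), hF]
  have hpos : 0 < ∫ y, ψ (w y) := by
    refine Continuous.integral_pos_of_hasCompactSupport_nonneg_nonzero (x := x)
      (hψc.comp hw) (hcs ψ hψ0) ?_ ?_
    · intro y
      by_cases hy : w y = 0
      · simp [hy, hψ0]
      · exact (hψpos _ hy).le
    · exact (hψpos _ (by rwa [hwv x hx])).ne'
  have i1 : Integrable (fun y => w y * g (w y)) :=
    Continuous.integrable_of_hasCompactSupport (hw.mul (hgc.comp hw))
      (hcs (fun t => t * g t) (by simp))
  have iG : Integrable (fun y => G (w y)) :=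
    Continuous.integrable_of_hasCompactSupport
      (((habs (q + 2) (by linarith)).div_const (q + 2)).comp hw) (hcs G hG0)
  have e : ∫ y, ψ (w y) = (∫ y, w y * g (w y)) - (q + 2) / 2 * ∫ y, G (w y) := by
    rw [← integral_const_mul, ← integral_sub i1 (iG.const_mul _)]
    congr 1
    funext y
    have : q + 2 ≠ 0 := by linarith
    simp only [ψ, G]
    field_simp
  rw [e, hq2] at hpos
  have h6 := mul_pos hN2 hpos
  have h7 : ((N:ℝ) - 2) * ((∫ y, w y * g (w y)) - 4 * N / ((N:ℝ) - 2) / 2 * ∫ y, G (w y)) =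
      ((N:ℝ) - 2) * (∫ y, w y * g (w y)) - 2 * N * ∫ y, G (w y) := by
    field_simp
    ring
  rw [h7] at h6
  linarith
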